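/- Let X be a topological space and Ω₀ a viable base of X (a ring of open sets that is also a base for the topology), and let ι : X → X̂_{Ω₀} be given by ι(x) = { I ∈ Idl(Ω₀) : x ∈ ⋃I }. Then for every open set W ⊆ X, ι(W) = O_{↓W} ∩ ι(X), where ↓W = { U ∈ Ω₀ : U ⊆ W }. Consequently ι is a topological quasi-embedding (continuous and relatively open). -/

import Mathlib

open Set TopologicalSpace

/-- The way-below relation: `x ≪ y` iff for every (nonempty) directed set `A`
whose supremum exists and satisfies `y ≤ ⊔ A`, some `d ∈ A` satisfies `x ≤ d`. -/
def WayBelow {α : Type*} [Preorder α] (x y : α) : Prop :=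
  ∀ A : Set α, A.Nonempty → DirectedOn (· ≤ ·) A → ∀ a : α, IsLUB A a → y ≤ a → ∃ d ∈ A, x ≤ d

/-- A complete lattice is continuous if every element is the directed supremum of the
elements way-below it. -/
def IsContinuousLattice (L : Type*) [CompleteLattice L] : Prop :=
  ∀ x : L, {a : L | WayBelow a x}.Nonempty ∧ DirectedOn (· ≤ ·) {a : L | WayBelow a x} ∧
    IsLUB {a : L | WayBelow a x} x

/-- A complete lattice is algebraic if every element is the directed supremum of the
finite (compact) elements below it. -/
def IsAlgebraicLattice (L : Type*) [CompleteLattice L] : Prop :=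
  ∀ x : L, {a : L | WayBelow a a ∧ a ≤ x}.Nonempty ∧
    DirectedOn (· ≤ ·) {a : L | WayBelow a a ∧ a ≤ x} ∧
    IsLUB {a : L | WayBelow a a ∧ a ≤ x} x

/-- A ring of open sets of `X`: a collection of open sets closed under finite unions
and finite intersections (hence containing `∅` and `X`). -/
structure IsOpenRing (X : Type*) [TopologicalSpace X] (Ω₀ : Set (Set X)) : Prop where
  isOpen : ∀ U ∈ Ω₀, IsOpen U
  empty_mem : (∅ : Set X) ∈ Ω₀
  univ_mem : (Set.univ : Set X) ∈ Ω₀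
  union_mem : ∀ U ∈ Ω₀, ∀ V ∈ Ω₀, U ∪ V ∈ Ω₀
  inter_mem : ∀ U ∈ Ω₀, ∀ V ∈ Ω₀, U ∩ V ∈ Ω₀

/-- An ideal of the poset `(Ω₀, ⊆)`: a nonempty, downward-closed, directed subset. -/
structure IsIdealOn {X : Type*} (Ω₀ : Set (Set X)) (I : Set (Set X)) : Prop where
  subset : I ⊆ Ω₀
  nonempty : I.Nonempty
  lower : ∀ U ∈ I, ∀ V ∈ Ω₀, V ⊆ U → V ∈ I
  directed : ∀ U ∈ I, ∀ V ∈ I, ∃ W ∈ I, U ⊆ W ∧ V ⊆ W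

/-- `Idl Ω₀`: the ideals of `Ω₀`, ordered by inclusion (the subtype order). -/
abbrev Idl {X : Type*} (Ω₀ : Set (Set X)) : Type _ := {I : Set (Set X) // IsIdealOn Ω₀ I}

/-- A completely prime filter of the complete lattice `Idl Ω₀`. -/
structure IsCPFilter {X : Type*} (Ω₀ : Set (Set X)) (F : Set (Idl Ω₀)) : Prop where
  nonempty : F.Nonempty
  upper : ∀ I ∈ F, ∀ J : Idl Ω₀, I ≤ J → J ∈ F
  inf_mem : ∀ I ∈ F, ∀ J ∈ F, ∀ K : Idl Ω₀, IsGLB {I, J} K → K ∈ F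
  prime : ∀ A : Set (Idl Ω₀), ∀ I : Idl Ω₀, IsLUB A I → I ∈ F → ∃ J ∈ A, J ∈ F

/-- The points of `Idl Ω₀`: its completely prime filters. -/
abbrev Pt {X : Type*} (Ω₀ : Set (Set X)) : Type _ := {F : Set (Idl Ω₀) // IsCPFilter Ω₀ F}

/-- The hull-kernel basic open set `O_I = { y : I ∈ y }`. -/
def ptOpen {X : Type*} {Ω₀ : Set (Set X)} (I : Idl Ω₀) : Set (Pt Ω₀) := {y : Pt Ω₀ | I ∈ y.1}

/-- The hull-kernel topology on `Pt Ω₀`, whose open sets are the sets `O_I`. -/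
def hullKernel {X : Type*} (Ω₀ : Set (Set X)) : TopologicalSpace (Pt Ω₀) :=
  TopologicalSpace.generateFrom {V : Set (Pt Ω₀) | ∃ I : Idl Ω₀, V = ptOpen I}

/-- The (principal) ideal `↓W = { U ∈ Ω₀ : U ⊆ W }` determined by a set `W`. -/
def principalIdl {X : Type*} [TopologicalSpace X] {Ω₀ : Set (Set X)} (hΩ : IsOpenRing X Ω₀)
    (W : Set X) : Idl Ω₀ :=
  ⟨{U : Set X | U ∈ Ω₀ ∧ U ⊆ W},
    { subset := fun U hU => hU.1
      nonempty := ⟨∅, hΩ.empty_mem, Set.empty_subset W⟩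
      lower := fun U hU V hV hVU => ⟨hV, hVU.trans hU.2⟩
      directed := fun U hU V hV =>
        ⟨U ∪ V, ⟨hΩ.union_mem U hU.1 V hV.1, Set.union_subset hU.2 hV.2⟩,
          Set.subset_union_left, Set.subset_union_right⟩ }⟩

/-- For a viable base `Ω₀` of `X` (a ring of open sets that is a base of the
topology), the map `ι : X → X̂_{Ω₀}` satisfies `ι(W) = O_{↓W} ∩ ι(X)` for every open
`W ⊆ X`; consequently `ι` is a topological quasi-embedding (continuous and relatively
open). -/
theorem iota_quasiEmbedding {X : Type*} [TopologicalSpace X] {Ω₀ : Set (Set X)}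
    (hΩ : IsOpenRing X Ω₀)
    (hbase : ∀ U : Set X, IsOpen U → ∀ x ∈ U, ∃ W ∈ Ω₀, x ∈ W ∧ W ⊆ U)
    (ι : X → Pt Ω₀)
    (hι : ∀ x : X, (ι x).1 = {I : Idl Ω₀ | x ∈ ⋃₀ I.1}) :
    (∀ W : Set X, IsOpen W → ι '' W = ptOpen (principalIdl hΩ W) ∩ Set.range ι) ∧
    @Continuous X (Pt Ω₀) _ (hullKernel Ω₀) ι ∧
    (∀ U : Set X, IsOpen U → ∃ V : Set (Pt Ω₀), @IsOpen _ (hullKernel Ω₀) V ∧ U = ι ⁻¹' V) := by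
  have key : ∀ (x : X) (I : Idl Ω₀), ι x ∈ ptOpen I ↔ x ∈ ⋃₀ I.1 := by
    intro x I
    change I ∈ (ι x).1 ↔ _
    rw [hι x]
    rfl
  have hun : ∀ W : Set X, IsOpen W → ∀ x : X, ι x ∈ ptOpen (principalIdl hΩ W) ↔ x ∈ W := by
    intro W hW x
    rw [key]
    constructor
    · rintro ⟨U, hU, hx⟩
      exact hU.2 hx
    · intro hx
      obtain ⟨U, hU, hxU, hUW⟩ := hbase W hW x hx
      exact ⟨U, ⟨hU, hUW⟩, hxU⟩
  refine ⟨?_, ?_, ?_⟩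
  · intro W hW
    ext y
    constructor
    · rintro ⟨x, hx, rfl⟩
      exact ⟨(hun W hW x).2 hx, x, rfl⟩
    · rintro ⟨hy, x, rfl⟩
      exact ⟨x, (hun W hW x).1 hy, rfl⟩
  · refine continuous_generateFrom_iff.2 ?_
    rintro V ⟨I, rfl⟩
    have h : ι ⁻¹' ptOpen I = ⋃₀ I.1 := by
      ext x
      exact key x I
    rw [h]
    exact isOpen_sUnion fun U hU => hΩ.isOpen U (I.2.subset hU)
  · intro U hU
    refine ⟨ptOpen (principalIdl hΩ U), TopologicalSpace.isOpen_generateFrom_of_mem ⟨_, rfl⟩, ?_⟩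
    ext x
    exact (hun U hU x).symm
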